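/- Let (R, m) be a commutative Noetherian local ring, M a finitely generated R-module of dimension d ≥ 1, and q an ideal of R generated by a system of parameters on M; put c = ℓ(M/qM). Then for any submodule N of M with depth(M/N) ≥ d − 1, the minimal number of generators of N satisfies μ(N) ≤ c. -/

import Mathlib

open Pointwise

/-- The length `ℓ(M)` of an `R`-module `M` (possibly infinite), defined as the supremum of the
lengths of strictly increasing chains of submodules of `M`. -/
noncomputable def moduleLength (R M : Type*) [CommRing R] [AddCommGroup M] [Module R M] : ℕ∞ :=
  ⨆ s : LTSeries (Submodule R M), (s.length : ℕ∞)

/-- The depth of a module `M` over a local ring `(R, m)`: the supremum of the lengths of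
(weakly) regular sequences on `M` consisting of elements of `m`.  For a nonzero finitely
generated module over a Noetherian local ring this is the common length of all maximal
`M`-regular sequences in `m`, and the depth of the zero module is `∞`. -/
noncomputable def moduleDepth (R M : Type*) [CommRing R] [IsLocalRing R]
    [AddCommGroup M] [Module R M] : ℕ∞ :=
  sSup {n : ℕ∞ | ∃ rs : List R, (∀ r ∈ rs, r ∈ IsLocalRing.maximalIdeal R) ∧
    RingTheory.Sequence.IsWeaklyRegular M rs ∧ (rs.length : ℕ∞) = n}

section Avoidance

variable {R : Type*} [CommRing R]

theorem Ideal.exists_add_notMem_of_forall_not_sup_le (a : R) (b : Ideal R) (S : Finset (Ideal R))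
    (hS : ∀ P ∈ S, P.IsPrime) (h : ∀ P ∈ S, ¬ Ideal.span {a} ⊔ b ≤ P) :
    ∃ y ∈ b, ∀ P ∈ S, a + y ∉ P := by
  classical
  induction hn : S.card generalizing S with
  | zero =>
    rw [Finset.card_eq_zero] at hn
    exact ⟨0, b.zero_mem, by simp [hn]⟩
  | succ n ih =>
    obtain ⟨P, hP⟩ := S.exists_minimal (Finset.card_pos.mp (by omega))
    obtain ⟨y, hyb, hy⟩ := ih (S.erase P) (fun Q hQ => hS Q (Finset.mem_of_mem_erase hQ))
      (fun Q hQ => h Q (Finset.mem_of_mem_erase hQ)) (by rw [Finset.card_erase_of_mem hP.1, hn]; rfl)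
    by_cases hay : a + y ∈ P
    · have hPp := hS P hP.1
      have hbP : ¬ b ≤ P := fun hb => h P hP.1 <| sup_le
        ((Ideal.span_singleton_le_iff_mem _).mpr ((P.add_mem_iff_left (hb hyb)).mp hay)) hb
      have hle : ¬ b ⊓ (S.erase P).inf id ≤ P := by
        rw [Ideal.IsPrime.inf_le hPp, Ideal.IsPrime.inf_le' hPp]
        rintro (hb | ⟨Q, hQ, hQP⟩)
        · exact hbP hb
        · exact Finset.ne_of_mem_erase hQ
            (le_antisymm hQP (hP.2 (Finset.mem_of_mem_erase hQ) hQP))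
      obtain ⟨z, hz, hzP⟩ := SetLike.not_le_iff_exists.mp hle
      refine ⟨y + z, b.add_mem hyb hz.1, fun Q hQ => ?_⟩
      rw [← add_assoc]
      by_cases hQP : Q = P
      · subst hQP
        exact fun hmem => hzP ((Q.add_mem_iff_right hay).mp hmem)
      · have hQ' := Finset.mem_erase.mpr ⟨hQP, hQ⟩
        have hzQ : z ∈ Q := (Finset.inf_le hQ' : (S.erase P).inf id ≤ Q) hz.2
        exact fun hmem => hy Q hQ' ((Q.add_mem_iff_left hzQ).mp hmem)
    · refine ⟨y, hyb, fun Q hQ => ?_⟩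
      by_cases hQP : Q = P
      · rwa [hQP]
      · exact hy Q (Finset.mem_erase.mpr ⟨hQP, hQ⟩)

theorem Submodule.exists_add_isSMulRegular_quotient [IsNoetherianRing R] {M : Type*}
    [AddCommGroup M] [Module R M] [Module.Finite R M] (a : R) (b : Ideal R)
    (T : Finset (Submodule R M))
    (h : ∀ K ∈ T, ∀ P ∈ associatedPrimes R (M ⧸ K), ¬ Ideal.span {a} ⊔ b ≤ P) :
    ∃ y ∈ b, ∀ K ∈ T, IsSMulRegular (M ⧸ K) (a + y) := by
  have hfin : (⋃ K ∈ T, associatedPrimes R (M ⧸ K)).Finite :=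
    T.finite_toSet.biUnion fun K _ => associatedPrimes.finite R (M ⧸ K)
  obtain ⟨y, hyb, hy⟩ := Ideal.exists_add_notMem_of_forall_not_sup_le a b hfin.toFinset
    (by
      simp only [Set.Finite.mem_toFinset, Set.mem_iUnion]
      rintro P ⟨K, -, hP⟩
      exact hP.isPrime)
    (by
      simp only [Set.Finite.mem_toFinset, Set.mem_iUnion]
      rintro P ⟨K, hK, hP⟩
      exact h K hK P hP)
  refine ⟨y, hyb, fun K hK => ?_⟩
  by_contra hreg
  have hmem : a + y ∈ ⋃ P ∈ associatedPrimes R (M ⧸ K), (P : Set R) := by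
    rw [biUnion_associatedPrimes_eq_compl_regular]
    exact hreg
  simp only [Set.mem_iUnion] at hmem
  obtain ⟨P, hP, haP⟩ := hmem
  refine hy P ?_ haP
  simp only [Set.Finite.mem_toFinset, Set.mem_iUnion]
  exact ⟨K, hK, hP⟩

end Avoidance

section Regular

variable {R M : Type*} [CommRing R] [AddCommGroup M] [Module R M]

theorem Submodule.isSMulRegular_quotient_sup_swap {N : Submodule R M} {x y : R}
    (hy : IsSMulRegular (M ⧸ N) y) (hx : IsSMulRegular (M ⧸ (N ⊔ y • ⊤)) x) :
    IsSMulRegular (M ⧸ (N ⊔ x • ⊤)) y := by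
  rw [isSMulRegular_quotient_iff_mem_of_smul_mem] at *
  intro a ha
  obtain ⟨n, hn, _, ⟨b, -, rfl⟩, hab⟩ := Submodule.mem_sup.mp ha
  change n + x • b = y • a at hab
  obtain ⟨n', hn', _, ⟨b', -, rfl⟩, hb⟩ := Submodule.mem_sup.mp <| hx b <| by
    rw [show x • b = -n + y • a by rw [← hab]; abel]
    exact Submodule.add_mem_sup (N.neg_mem hn) ⟨a, trivial, rfl⟩
  change n' + y • b' = b at hb
  have hmem : a - x • b' ∈ N := hy _ <| by
    rw [smul_sub, ← hab, ← hb, smul_add, smul_comm y x b',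
      show n + (x • n' + x • y • b') - x • y • b' = n + x • n' by abel]
    exact N.add_mem hn (N.smul_mem _ hn')
  rw [← sub_add_cancel a (x • b')]
  exact Submodule.add_mem_sup hmem ⟨b', trivial, rfl⟩

theorem Submodule.smul_mem_imp_mem_sup_swap {I : Ideal R} {N : Submodule R M} {x y : R}
    (hyI : y ∈ I) (hx : IsSMulRegular (M ⧸ N) x) (hy : IsSMulRegular (M ⧸ N) y)
    (h : ∀ a : M, (∀ r ∈ I, r • a ∈ N ⊔ y • (⊤ : Submodule R M)) → a ∈ N ⊔ y • (⊤ : Submodule R M))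
    (a : M) (ha : ∀ r ∈ I, r • a ∈ N ⊔ x • (⊤ : Submodule R M)) :
    a ∈ N ⊔ x • (⊤ : Submodule R M) := by
  rw [isSMulRegular_quotient_iff_mem_of_smul_mem] at *
  obtain ⟨n, hn, _, ⟨b, -, rfl⟩, hab⟩ := Submodule.mem_sup.mp (ha y hyI)
  change n + x • b = y • a at hab
  obtain ⟨n', hn', _, ⟨b', -, rfl⟩, hb⟩ := Submodule.mem_sup.mp <| h b <| by
    intro r hr
    obtain ⟨k, hk, _, ⟨e, -, rfl⟩, hke⟩ := Submodule.mem_sup.mp (ha r hr)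
    change k + x • e = r • a at hke
    have hmem : r • b - y • e ∈ N := hx _ <| by
      rw [show x • (r • b - y • e) = y • k - r • n by
        rw [smul_sub, smul_comm x r, smul_comm x y, show x • b = y • a - n by rw [← hab]; abel,
          show x • e = r • a - k by rw [← hke]; abel, smul_sub, smul_sub, smul_comm r y]
        abel]
      exact N.sub_mem (N.smul_mem _ hk) (N.smul_mem _ hn)
    rw [← sub_add_cancel (r • b) (y • e)]
    exact Submodule.add_mem_sup hmem ⟨e, trivial, rfl⟩
  change n' + y • b' = b at hb
  have hmem : a - x • b' ∈ N := hy _ <| by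
    rw [smul_sub, ← hab, ← hb, smul_add, smul_comm y x b',
      show n + (x • n' + x • y • b') - x • y • b' = n + x • n' by abel]
    exact N.add_mem hn (N.smul_mem _ hn')
  rw [← sub_add_cancel a (x • b')]
  exact Submodule.add_mem_sup hmem ⟨b', trivial, rfl⟩

/-- The quotient `M ⧸ N` admits a weakly regular sequence of length `n` in the ideal `I`. -/
def Submodule.HasRegularSeq : Submodule R M → Ideal R → ℕ → Prop
  | _, _, 0 => True
  | N, I, n + 1 => ∃ x ∈ I, IsSMulRegular (M ⧸ N) x ∧ HasRegularSeq (N ⊔ x • ⊤) I n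

theorem Submodule.hasRegularSeq_of_isWeaklyRegular {I : Ideal R} (rs : List R)
    (hrs : ∀ r ∈ rs, r ∈ I) (N : Submodule R M)
    (hreg : RingTheory.Sequence.IsWeaklyRegular (M ⧸ N) rs) (n : ℕ) (hn : n ≤ rs.length) :
    N.HasRegularSeq I n := by
  induction rs generalizing N n with
  | nil =>
    obtain rfl : n = 0 := by simpa using hn
    trivial
  | cons x rs ih =>
    cases n with
    | zero => trivial
    | succ n =>
      rw [RingTheory.Sequence.isWeaklyRegular_cons_iff] at hreg
      simp only [List.mem_cons, forall_eq_or_imp] at hrs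
      refine ⟨x, hrs.1, hreg.1, ih hrs.2 _ ?_ n (by simpa using hn)⟩
      have hmap : x • (⊤ : Submodule R (M ⧸ N)) = (x • ⊤ : Submodule R M).map N.mkQ := by
        rw [Submodule.map_pointwise_smul, Submodule.map_top, Submodule.range_mkQ]
      exact (((Submodule.quotEquivOfEq _ _ hmap).trans
        (Submodule.quotientQuotientEquivQuotientSup N (x • ⊤))).isWeaklyRegular_congr rs).mp hreg.2

theorem Submodule.HasRegularSeq.of_comap {M' : Type*} [AddCommGroup M'] [Module R M']
    {I : Ideal R} {g : M →ₗ[R] M'} (hg : Function.Surjective g) {n : ℕ} {N : Submodule R M'}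
    (h : (N.comap g).HasRegularSeq I n) : N.HasRegularSeq I n := by
  induction n generalizing N with
  | zero => trivial
  | succ n ih =>
    obtain ⟨x, hxI, hx, hn⟩ := h
    refine ⟨x, hxI, ?_, ih ?_⟩
    · rw [isSMulRegular_quotient_iff_mem_of_smul_mem] at hx ⊢
      intro a ha
      obtain ⟨a, rfl⟩ := hg a
      exact hx a (by simpa using ha)
    · convert hn using 1
      rw [show N ⊔ x • ⊤ = (N.comap g ⊔ x • ⊤).map g by
        rw [Submodule.map_sup, Submodule.map_comap_eq_of_surjective hg,
          Submodule.map_pointwise_smul, Submodule.map_top, LinearMap.range_eq_top.mpr hg],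
        Submodule.comap_map_eq, sup_eq_left.mpr]
      exact (LinearMap.ker_le_comap g).trans le_sup_left

variable [IsNoetherianRing R] [IsLocalRing R] [Module.Finite R M]

open IsLocalRing

theorem Submodule.exists_isSMulRegular_quotient_of_forall_smul_mem (T : Finset (Submodule R M))
    (h : ∀ K ∈ T, ∀ a : M, (∀ r ∈ maximalIdeal R, r • a ∈ K) → a ∈ K) :
    ∃ z ∈ maximalIdeal R, ∀ K ∈ T, IsSMulRegular (M ⧸ K) z := by
  obtain ⟨z, hz, hreg⟩ := Submodule.exists_add_isSMulRegular_quotient 0 (maximalIdeal R) T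
    (by
      intro K hK P hP hle
      obtain ⟨hprime, w, rfl⟩ := isAssociatedPrime_iff.mp hP
      obtain ⟨w, rfl⟩ := Submodule.mkQ_surjective _ w
      have hw : K.mkQ w = 0 := by
        rw [Submodule.mkQ_apply, Submodule.Quotient.mk_eq_zero]
        refine h _ hK w fun r hr => ?_
        have := Submodule.mem_colon_singleton.mp (hle (Ideal.mem_sup_right hr))
        rwa [Submodule.mem_bot, ← map_smul, Submodule.mkQ_apply,
          Submodule.Quotient.mk_eq_zero] at this
      apply hprime.ne_top
      rw [hw]
      exact Ideal.eq_top_of_isUnit_mem _ (by simp) isUnit_one)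
  exact ⟨z, hz, by simpa using hreg⟩

theorem Submodule.HasRegularSeq.exchange {n : ℕ} {N : Submodule R M} {x y : R}
    (hxm : x ∈ maximalIdeal R) (hym : y ∈ maximalIdeal R)
    (hx : IsSMulRegular (M ⧸ N) x) (hy : IsSMulRegular (M ⧸ N) y)
    (h : (N ⊔ y • ⊤).HasRegularSeq (maximalIdeal R) n) :
    (N ⊔ x • ⊤).HasRegularSeq (maximalIdeal R) n := by
  classical
  induction n generalizing N x y with
  | zero => trivial
  | succ n ih =>
    obtain ⟨w, hwm, hw, hn⟩ := h
    have hsoc : ∀ (K : Submodule R M) {v : R}, v ∈ maximalIdeal R → IsSMulRegular (M ⧸ K) v →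
        ∀ a : M, (∀ r ∈ maximalIdeal R, r • a ∈ K) → a ∈ K := fun K v hv hreg a ha =>
      (isSMulRegular_quotient_iff_mem_of_smul_mem _ _).mp hreg a (ha v hv)
    obtain ⟨z, hzm, hz⟩ := Submodule.exists_isSMulRegular_quotient_of_forall_smul_mem
      {N ⊔ y • ⊤, N ⊔ x • ⊤} (by
        simp only [Finset.mem_insert, Finset.mem_singleton, forall_eq_or_imp, forall_eq]
        exact ⟨hsoc _ hwm hw,
          Submodule.smul_mem_imp_mem_sup_swap hym hx hy (hsoc _ hwm hw)⟩)
    simp only [Finset.mem_insert, Finset.mem_singleton, forall_eq_or_imp, forall_eq] at hz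
    obtain ⟨hzy, hzx⟩ := hz
    have h1 := ih hzm hwm hzy hw hn
    rw [sup_right_comm] at h1
    have h2 := ih hxm hym (Submodule.isSMulRegular_quotient_sup_swap hx hzx)
      (Submodule.isSMulRegular_quotient_sup_swap hy hzy) h1
    rw [sup_right_comm] at h2
    exact ⟨z, hzm, hzx, h2⟩

end Regular

section Length
variable {R M : Type*} [CommRing R] [AddCommGroup M] [Module R M]

theorem Module.exists_finset_card_le_span_eq_top {c : ℕ} (hc : Module.length R M ≤ c) :
    ∃ s : Finset M, s.card ≤ c ∧ Submodule.span R (s : Set M) = ⊤ := by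
  classical
  induction c generalizing M with
  | zero =>
    have : Subsingleton M := Module.length_eq_zero_iff.mp (by simpa using hc)
    exact ⟨∅, by simp, Subsingleton.elim _ _⟩
  | succ c ih =>
    rcases subsingleton_or_nontrivial M with _ | _
    · exact ⟨∅, by simp, Subsingleton.elim _ _⟩
    · obtain ⟨v, hv⟩ := exists_ne (0 : M)
      obtain ⟨_, _⟩ := isFiniteLength_iff_isNoetherian_isArtinian.mp
        (Module.length_ne_top_iff.mp (hc.trans_lt (ENat.natCast_lt_top _)).ne)
      have hlt := (Submodule.length_quotient_lt (Submodule.span R {v})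
        (by simpa using hv)).trans_le hc
      obtain ⟨t, htc, ht⟩ := ih (M := M ⧸ Submodule.span R {v})
        (ENat.lt_add_one_iff (ENat.natCast_ne_top c) |>.mp (by exact_mod_cast hlt))
      refine ⟨insert v (t.image Quotient.out), (Finset.card_insert_le _ _).trans
        (Nat.succ_le_succ (Finset.card_image_le.trans htc)), ?_⟩
      have hmap : (Submodule.span R (t.image Quotient.out : Set M)).map
          (Submodule.span R {v}).mkQ = ⊤ := by
        rw [Submodule.map_span, ← ht]
        congr 1
        ext x
        simp
      rw [Submodule.map_mkQ_eq_top] at hmap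
      rw [Finset.coe_insert, Submodule.span_insert]
      simpa using hmap

theorem Submodule.length_quotient_eq_add {A B : Submodule R M} (h : A ≤ B) :
    Module.length R (M ⧸ A) = Module.length R (B.map A.mkQ) + Module.length R (M ⧸ B) := by
  rw [← (Submodule.quotientQuotientEquivQuotient A B h).length_eq]
  exact Module.length_eq_add_of_exact (B.map A.mkQ).subtype (B.map A.mkQ).mkQ
    (Submodule.subtype_injective _) (Submodule.mkQ_surjective _)
    (LinearMap.exact_subtype_mkQ _)

/-- If `M ⧸ P` has finite length, then `P ⧸ x P` is no longer than `M ⧸ x M`. -/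
theorem Submodule.length_map_mkQ_smul_le (P : Submodule R M) (x : R)
    (hP : Module.length R (M ⧸ P) ≠ ⊤) :
    Module.length R (P.map (x • P).mkQ) ≤ Module.length R (M ⧸ (x • ⊤ : Submodule R M)) := by
  have h1 := Submodule.length_quotient_eq_add (Submodule.smul_le_self_of_tower x P)
  have h2 := Submodule.length_quotient_eq_add (A := x • P) (B := x • ⊤)
    (by
      rintro _ ⟨a, -, rfl⟩
      exact ⟨a, trivial, rfl⟩)
  have h3 : Module.length R ((x • ⊤ : Submodule R M).map (x • P).mkQ) ≤
      Module.length R (M ⧸ P) := by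
    let φ : M ⧸ P →ₗ[R] M ⧸ x • P := P.mapQ (x • P) (LinearMap.lsmul R M x)
      (fun a ha => ⟨a, ha, rfl⟩)
    have hφ : (x • ⊤ : Submodule R M).map (x • P).mkQ = LinearMap.range φ := by
      ext a
      constructor
      · rintro ⟨_, ⟨b, -, rfl⟩, rfl⟩
        exact ⟨P.mkQ b, rfl⟩
      · rintro ⟨b, rfl⟩
        obtain ⟨b, rfl⟩ := P.mkQ_surjective b
        exact ⟨x • b, ⟨b, trivial, rfl⟩, rfl⟩
    rw [hφ]
    exact Module.length_le_of_surjective φ.rangeRestrict φ.surjective_rangeRestrict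
  have h4 : Module.length R (P.map (x • P).mkQ) + Module.length R (M ⧸ P) ≤
      Module.length R (M ⧸ (x • ⊤ : Submodule R M)) + Module.length R (M ⧸ P) := by
    rw [← h1, h2, add_comm]
    gcongr
  exact (ENat.add_le_add_iff_right hP).mp h4

theorem Module.length_quotient_pow_smul_ne_top (x : R) (n : ℕ)
    (h : Module.length R (M ⧸ (x • ⊤ : Submodule R M)) ≠ ⊤) :
    Module.length R (M ⧸ (x ^ n • ⊤ : Submodule R M)) ≠ ⊤ := by
  induction n with
  | zero =>
    have : Subsingleton (M ⧸ (x ^ 0 • ⊤ : Submodule R M)) :=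
      Submodule.Quotient.subsingleton_iff.mpr (by simp)
    simp
  | succ n ih =>
    have := Submodule.length_map_mkQ_smul_le (x ^ n • ⊤ : Submodule R M) x ih
    rw [pow_succ', mul_smul, Submodule.length_quotient_eq_add
      (Submodule.smul_le_self_of_tower x (x ^ n • ⊤ : Submodule R M))]
    exact WithTop.add_ne_top.mpr ⟨(this.trans_lt h.lt_top).ne, ih⟩

theorem Submodule.exists_finset_span_eq_of_inf_le_smul [IsNoetherian R M] {N Q : Submodule R M}
    {x : R} (hx : x ∈ (⊥ : Ideal R).jacobson) (hQ : Q ⊓ N ≤ x • N) (t : Finset (M ⧸ Q))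
    (ht : Submodule.span R (t : Set (M ⧸ Q)) = N.map Q.mkQ) :
    ∃ s : Finset M, s.card ≤ t.card ∧ Submodule.span R (s : Set M) = N := by
  classical
  have hlift : (t : Set (M ⧸ Q)) ⊆ Q.mkQ '' N := by
    rw [← Submodule.map_coe, ← ht]
    exact Submodule.subset_span
  obtain ⟨s, hsN, hcard, hst⟩ : ∃ s : Finset M, (s : Set M) ⊆ N ∧ s.card ≤ t.card ∧
      Q.mkQ '' (s : Set M) = t := by
    choose! g hgN hg using hlift
    refine ⟨t.image g, ?_, Finset.card_image_le, ?_⟩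
    · rw [Finset.coe_image]
      exact Set.image_subset_iff.mpr fun w hw => hgN hw
    · rw [Finset.coe_image, Set.image_image]
      exact (Set.image_congr fun w hw => hg hw).trans (Set.image_id _)
  have hle : Submodule.span R (s : Set M) ≤ N := Submodule.span_le.mpr hsN
  refine ⟨s, hcard, le_antisymm hle ?_⟩
  refine Submodule.le_of_le_smul_of_le_jacobson_bot (I := Ideal.span {x})
    (IsNoetherian.noetherian N) ((Ideal.span_singleton_le_iff_mem _).mpr hx) ?_
  have hNle : N ≤ Submodule.span R (s : Set M) ⊔ Q := by
    have := Submodule.le_comap_map Q.mkQ N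
    rwa [← ht, ← hst, ← Submodule.map_span, Submodule.comap_map_mkQ, sup_comm] at this
  rw [Submodule.ideal_span_singleton_smul]
  intro a ha
  obtain ⟨b, hb, e, he, rfl⟩ := Submodule.mem_sup.mp (hNle ha)
  exact Submodule.add_mem_sup hb (hQ ⟨he, (N.add_mem_iff_right (hle hb)).mp ha⟩)

theorem Submodule.exists_finset_card_le_span_eq_of_length_quotient_smul_le [IsNoetherianRing R]
    [Module.Finite R M] (N : Submodule R M) {x : R} (hx : x ∈ (⊥ : Ideal R).jacobson) {c : ℕ}
    (hc : Module.length R (M ⧸ (x • ⊤ : Submodule R M)) ≤ c) :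
    ∃ s : Finset M, s.card ≤ c ∧ Submodule.span R (s : Set M) = N := by
  classical
  obtain ⟨k, hk⟩ := Ideal.exists_pow_inf_eq_pow_smul (Ideal.span {x}) N
  have hinf : (x ^ (k + 1) • ⊤ : Submodule R M) ⊓ N ≤ x • N := by
    have h := hk (k + 1) (Nat.le_succ k)
    rw [Nat.add_sub_cancel_left, pow_one, Ideal.span_singleton_pow,
      Submodule.ideal_span_singleton_smul, Submodule.ideal_span_singleton_smul] at h
    rw [h]
    exact Submodule.map_mono inf_le_right
  set P := N ⊔ x ^ (k + 1) • (⊤ : Submodule R M) with hPdef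
  set Q := x • N ⊔ x ^ (k + 1) • (⊤ : Submodule R M) with hQdef
  have hfin : Module.length R (M ⧸ (x • ⊤ : Submodule R M)) ≠ ⊤ :=
    (hc.trans_lt (ENat.natCast_lt_top _)).ne
  have hPfin : Module.length R (M ⧸ P) ≠ ⊤ :=
    ((Module.length_le_of_surjective (Submodule.factor (le_sup_right : _ ≤ P))
      (Submodule.factor_surjective _)).trans_lt
        (Module.length_quotient_pow_smul_ne_top x (k + 1) hfin).lt_top).ne
  have hPQ : x • P ≤ Q := by
    rw [hPdef, Submodule.smul_sup']
    exact sup_le_sup_left (Submodule.smul_le_self_of_tower _ _) _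
  have hmap : (P.map (x • P).mkQ).map (Submodule.factor hPQ) = N.map Q.mkQ := by
    rw [← Submodule.map_comp, Submodule.factor_comp_mk, hPdef, Submodule.map_sup, sup_eq_left]
    refine le_trans (Submodule.map_mono le_sup_right) ((Submodule.mkQ_map_self Q).trans_le bot_le)
  have hlen : Module.length R (N.map Q.mkQ) ≤ c := by
    rw [← hmap]
    refine le_trans ?_ ((Submodule.length_map_mkQ_smul_le P x hPfin).trans hc)
    exact Module.length_le_of_surjective ((Submodule.factor hPQ).submoduleMap _)
      (LinearMap.submoduleMap_surjective _ _)
  obtain ⟨t, htc, ht⟩ := Module.exists_finset_card_le_span_eq_top hlen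
  refine (Submodule.exists_finset_span_eq_of_inf_le_smul hx ?_ (t.image Subtype.val) ?_).imp
    fun s hs => ⟨hs.1.trans (Finset.card_image_le.trans htc), hs.2⟩
  · rw [hQdef, sup_inf_assoc_of_le _ (Submodule.smul_le_self_of_tower x N)]
    exact sup_le le_rfl hinf
  · rw [Finset.coe_image, ← Submodule.coe_subtype, ← Submodule.map_span, ht, Submodule.map_top,
      Submodule.range_subtype]

end Length

section Generators

open IsLocalRing

theorem IsLocalRing.maximalIdeal_le_of_length_quotient_smul_ne_top {R M : Type*} [CommRing R]
    [IsNoetherianRing R] [IsLocalRing R] [AddCommGroup M] [Module R M] [Module.Finite R M]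
    {q P : Ideal R} (hP : P.IsPrime) (hq : Module.length R (M ⧸ (q • ⊤ : Submodule R M)) ≠ ⊤)
    (hqP : q ≤ P) (hMP : Module.annihilator R M ≤ P) : maximalIdeal R ≤ P := by
  intro y hy
  obtain ⟨_, _⟩ := isFiniteLength_iff_isNoetherian_isArtinian.mp (Module.length_ne_top_iff.mp hq)
  have hsupp : (⟨P, hP⟩ : PrimeSpectrum R) ∈
      Module.support R (M ⧸ (q • ⊤ : Submodule R M)) := by
    rw [Module.support_quotient]
    exact ⟨Module.mem_support_iff_of_finite.mpr hMP, hqP⟩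
  rw [Module.mem_support_iff_of_finite] at hsupp
  let g : ℕ →o (Submodule R (M ⧸ (q • ⊤ : Submodule R M)))ᵒᵈ :=
    ⟨fun n => OrderDual.toDual (y ^ n • ⊤), monotone_nat_of_le_succ fun n => by
      change y ^ (n + 1) • (⊤ : Submodule R (M ⧸ (q • ⊤ : Submodule R M))) ≤ y ^ n • ⊤
      rw [pow_succ', mul_smul]
      exact Submodule.smul_le_self_of_tower _ _⟩
  obtain ⟨n, hn⟩ := IsArtinian.monotone_stabilizes g
  have hn1 : y ^ n • (⊤ : Submodule R (M ⧸ (q • ⊤ : Submodule R M))) = y ^ (n + 1) • ⊤ :=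
    hn (n + 1) n.le_succ
  have hbot : y ^ n • (⊤ : Submodule R (M ⧸ (q • ⊤ : Submodule R M))) = ⊥ := by
    refine Submodule.eq_bot_of_le_smul_of_le_jacobson_bot (Ideal.span {y}) _
      (IsNoetherian.noetherian _) ?_ ?_
    · rw [Submodule.ideal_span_singleton_smul, ← mul_smul, ← pow_succ', ← hn1]
    · rw [IsLocalRing.jacobson_eq_maximalIdeal _ bot_ne_top]
      exact (Ideal.span_singleton_le_iff_mem _).mpr hy
  refine hP.mem_of_pow_mem n (hsupp (Module.mem_annihilator.mpr fun a => ?_))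
  have ha : y ^ n • a ∈ y ^ n • (⊤ : Submodule R (M ⧸ (q • ⊤ : Submodule R M))) :=
    ⟨a, trivial, rfl⟩
  rwa [hbot] at ha

theorem Submodule.HasRegularSeq.exists_finset_card_le_span_eq {R : Type*} [CommRing R]
    [IsNoetherianRing R] [IsLocalRing R] {M : Type*} [AddCommGroup M] [Module R M]
    [Module.Finite R M] {c n : ℕ} (f : Fin (n + 1) → R) (hf : ∀ i, f i ∈ maximalIdeal R)
    (hc : Module.length R (M ⧸ (Ideal.span (Set.range f) • ⊤ : Submodule R M)) ≤ c)
    {N : Submodule R M} (h : N.HasRegularSeq (maximalIdeal R) n) :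
    ∃ s : Finset M, s.card ≤ c ∧ Submodule.span R (s : Set M) = N := by
  have hjac : (⊥ : Ideal R).jacobson = maximalIdeal R :=
    IsLocalRing.jacobson_eq_maximalIdeal _ bot_ne_top
  induction n generalizing M with
  | zero =>
    refine N.exists_finset_card_le_span_eq_of_length_quotient_smul_le (hjac ▸ hf 0) ?_
    have hrange : Set.range f = {f 0} := Set.range_unique (ι := Fin 1) (f := f)
    rwa [hrange, Submodule.ideal_span_singleton_smul] at hc
  | succ n ih =>
    obtain ⟨y, hym, hy, hn⟩ := h
    have hrange : Ideal.span {f 0} ⊔ Ideal.span (Set.range (Fin.tail f)) =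
        Ideal.span (Set.range f) := by
      rw [← Ideal.span_union, ← Set.insert_eq]
      congr 1
      rw [← Fin.range_cons, Fin.cons_self_tail]
    obtain ⟨z, hz, hreg⟩ := Submodule.exists_add_isSMulRegular_quotient (f 0)
      (Ideal.span (Set.range (Fin.tail f))) {N} (by
        simp only [Finset.mem_singleton, forall_eq]
        intro P hP hle
        rw [hrange] at hle
        have hyP : y ∈ ⋃ P ∈ associatedPrimes R (M ⧸ N), (P : Set R) :=
          Set.mem_biUnion hP <| maximalIdeal_le_of_length_quotient_smul_ne_top hP.isPrime
            (hc.trans_lt (ENat.natCast_lt_top _)).ne hle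
            ((LinearMap.annihilator_le_of_surjective _ N.mkQ_surjective).trans
              (Submodule.annihilator_top.symm.trans_le hP.annihilator_le)) hym
        rw [biUnion_associatedPrimes_eq_compl_regular] at hyP
        exact hyP hy)
    have hx := hreg N (Finset.mem_singleton_self N)
    have hxm : f 0 + z ∈ maximalIdeal R := Ideal.add_mem _ (hf 0) <|
      (Ideal.span_le.mpr (by rintro _ ⟨i, rfl⟩; exact hf i.succ)) hz
    set x := f 0 + z with hxdef
    have hle : (Ideal.span (Set.range f) • ⊤ : Submodule R M) ≤
        x • ⊤ ⊔ Ideal.span (Set.range (Fin.tail f)) • ⊤ := by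
      rw [← Submodule.ideal_span_singleton_smul, ← Submodule.sup_smul, ← hrange]
      refine Submodule.smul_mono_left (sup_le ?_ le_sup_right)
      rw [Ideal.span_singleton_le_iff_mem, show f 0 = x - z by rw [hxdef]; abel]
      exact Ideal.sub_mem _ (Ideal.mem_sup_left (Ideal.mem_span_singleton_self x))
        (Ideal.mem_sup_right hz)
    have hlen : Module.length R ((M ⧸ (x • ⊤ : Submodule R M)) ⧸
        (Ideal.span (Set.range (Fin.tail f)) • ⊤ : Submodule R (M ⧸ (x • ⊤ : Submodule R M)))) ≤
        c := by
      have hmap : (Ideal.span (Set.range (Fin.tail f)) • ⊤ :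
          Submodule R (M ⧸ (x • ⊤ : Submodule R M))) =
          (Ideal.span (Set.range (Fin.tail f)) • ⊤ : Submodule R M).map
            (x • ⊤ : Submodule R M).mkQ := by
        rw [Submodule.map_smul'', Submodule.map_top, Submodule.range_mkQ]
      rw [((Submodule.quotEquivOfEq _ _ hmap).trans
        (Submodule.quotientQuotientEquivQuotientSup _ _)).length_eq]
      exact (Module.length_le_of_surjective (Submodule.factor hle)
        (Submodule.factor_surjective _)).trans hc
    obtain ⟨t, htc, ht⟩ := ih (Fin.tail f) (fun i => hf i.succ) hlen
      (N := N.map (x • ⊤ : Submodule R M).mkQ)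
      (.of_comap (Submodule.mkQ_surjective _) (by
        rw [Submodule.comap_map_mkQ, sup_comm]
        exact hn.exchange hxm hym hx hy))
    exact (Submodule.exists_finset_span_eq_of_inf_le_smul (hjac ▸ hxm)
      (smul_top_inf_eq_smul_of_isSMulRegular_on_quot hx) t ht).imp
        fun s hs => ⟨hs.1.trans htc, hs.2⟩

theorem moduleLength_eq_length (R M : Type*) [CommRing R] [AddCommGroup M] [Module R M] :
    moduleLength R M = Module.length R M := by
  apply WithBot.coe_injective
  rw [Module.coe_length, Order.krullDim_eq_iSup_length]
  rfl

theorem Submodule.hasRegularSeq_of_le_moduleDepth {R M : Type*} [CommRing R] [IsLocalRing R]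
    [AddCommGroup M] [Module R M] {N : Submodule R M} {n : ℕ}
    (h : (n : ℕ∞) ≤ moduleDepth R (M ⧸ N)) : N.HasRegularSeq (maximalIdeal R) n := by
  cases n with
  | zero => trivial
  | succ n =>
    obtain ⟨_, ⟨rs, hrs, hreg, rfl⟩, hlt⟩ := lt_sSup_iff.mp
      ((ENat.natCast_lt_natCast.mpr n.lt_succ_self).trans_le h)
    exact Submodule.hasRegularSeq_of_isWeaklyRegular rs hrs N hreg _
      (ENat.natCast_lt_natCast.mp hlt)

end Generators

/-- **Corollary 4 (Main Theorem).** Let `(R, m)` be a commutative Noetherian local ring, `M` a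
finitely generated `R`-module of dimension `d ≥ 1`, and `q` an ideal generated by a system of
parameters on `M`; put `c = ℓ(M/qM)`.  Then any submodule `N` of `M` with
`depth (M/N) ≥ d − 1` satisfies `μ(N) ≤ c`, i.e. `N` is generated by at most `c` elements. -/
theorem generators_bound_of_depth_quotient_ge
    {R : Type*} [CommRing R] [IsNoetherianRing R] [IsLocalRing R]
    (M : Type*) [AddCommGroup M] [Module R M] [Module.Finite R M]
    (d : ℕ) (hd : 1 ≤ d)
    (hdim : ringKrullDim (R ⧸ Module.annihilator R M) = d)
    (q : Ideal R) (f : Fin d → R) (hfm : ∀ i, f i ∈ IsLocalRing.maximalIdeal R)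
    (hq : q = Ideal.span (Set.range f))
    (c : ℕ) (hc : moduleLength R (M ⧸ (q • ⊤ : Submodule R M)) = c)
    (N : Submodule R M)
    (hdepth : ((d - 1 : ℕ) : ℕ∞) ≤ moduleDepth R (M ⧸ N)) :
    ∃ s : Finset M, s.card ≤ c ∧ Submodule.span R (s : Set M) = N := by
  subst hq
  obtain ⟨n, rfl⟩ := Nat.exists_eq_add_of_le' hd
  rw [moduleLength_eq_length] at hc
  exact (Submodule.hasRegularSeq_of_le_moduleDepth hdepth).exists_finset_card_le_span_eq f hfm hc.le
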